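/- arXiv:1812.09981 — 2 statements merged into one kernel-verified Lean document; each statement's English description precedes it below -/
import Mathlib

section
/- Let A be a Bernstein algebra over a field K of characteristic ≠ 2, 3, with barideal N = ker(ω). Then A is Noetherian (satisfies the ascending chain condition on ideals of A) if and only if the algebra N is Noetherian (satisfies the ascending chain condition on ideals of N). -/
section PeirceDecomposition

variable {K A : Type*} [Field K] [NonUnitalNonAssocCommRing A] [Module K A]
  [SMulCommClass K A A]

/-- The Peirce component `U = {u | 2 e u = u}` of an element `e`. -/
def peirceHalf (K : Type*) {A : Type*} [Field K] [NonUnitalNonAssocCommRing A] [Module K A]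
    [SMulCommClass K A A] (e : A) : Submodule K A where
  carrier := {u | (2 : K) • (e * u) = u}
  add_mem' {a b} ha hb := by
    simp only [Set.mem_ofPred_eq, mul_add, smul_add] at *
    rw [ha, hb]
  zero_mem' := by simp
  smul_mem' c a ha := by
    simp only [Set.mem_ofPred_eq] at *
    rw [mul_smul_comm, smul_comm, ha]

/-- The Peirce component `V = {v | e v = 0}` of an element `e`. -/
def peirceZero (K : Type*) {A : Type*} [Field K] [NonUnitalNonAssocCommRing A] [Module K A]
    [SMulCommClass K A A] (e : A) : Submodule K A where
  carrier := {v | e * v = 0}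
  add_mem' {a b} ha hb := by
    simp only [Set.mem_ofPred_eq, mul_add] at *
    rw [ha, hb, add_zero]
  zero_mem' := by simp
  smul_mem' c a ha := by
    simp only [Set.mem_ofPred_eq] at *
    rw [mul_smul_comm, ha, smul_zero]

theorem mem_peirceHalf {e u : A} : u ∈ peirceHalf K e ↔ (2 : K) • (e * u) = u := Iff.rfl

theorem mem_peirceZero {e v : A} : v ∈ peirceZero K e ↔ e * v = 0 := Iff.rfl

theorem mul_mem_of_mem_peirceHalf (h2 : (2 : K) ≠ 0) {e u : A} (hu : u ∈ peirceHalf K e)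
    {S : Submodule K A} (hS : u ∈ S) : e * u ∈ S := by
  rw [mem_peirceHalf] at hu
  rw [← hu] at hS
  exact (S.smul_mem_iff h2).1 hS

theorem eq_zero_of_mem_peirceHalf_of_mem_peirceZero {e x : A} (hU : x ∈ peirceHalf K e)
    (hV : x ∈ peirceZero K e) : x = 0 := by
  rw [mem_peirceHalf, mem_peirceZero.1 hV, smul_zero] at hU
  exact hU.symm

/-- The Peirce decomposition of a Bernstein algebra with respect to an element `e` of weight
one, together with the product relations between the components `U` and `V`. -/
structure HasPeirceDecomposition (ω : A →ₗ[K] K) (e : A) : Prop where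
  weight : ω e = 1
  exists_add : ∀ x ∈ LinearMap.ker ω, ∃ u ∈ peirceHalf K e, ∃ v ∈ peirceZero K e, u + v = x
  half_le : peirceHalf K e ≤ LinearMap.ker ω
  zero_le : peirceZero K e ≤ LinearMap.ker ω
  half_mul_half : ∀ u ∈ peirceHalf K e, ∀ u' ∈ peirceHalf K e, u * u' ∈ peirceZero K e
  half_mul_zero : ∀ u ∈ peirceHalf K e, ∀ v ∈ peirceZero K e, u * v ∈ peirceHalf K e
  zero_mul_zero : ∀ v ∈ peirceZero K e, ∀ v' ∈ peirceZero K e, v * v' ∈ peirceHalf K e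
  half_mul_zero_mul_zero : ∀ u ∈ peirceHalf K e, ∀ v ∈ peirceZero K e, ∀ v' ∈ peirceZero K e,
    u * (v * v') = 0
  half_mul_half_mul_zero : ∀ u ∈ peirceHalf K e, ∀ u' ∈ peirceHalf K e, ∀ v ∈ peirceZero K e,
    u * (v * u') = -((u * v) * u')

section Identities

variable [IsScalarTower K A A] {ω : A →ₗ[K] K} {e : A}

/-- The homogeneous components of the Bernstein identity at `e + t y`, for `y` of weight zero. -/
theorem bernstein_components (h2 : (2 : K) ≠ 0) (h3 : (3 : K) ≠ 0)
    (hbern : ∀ x : A, (x * x) * (x * x) = ω x ^ 2 • (x * x))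
    (hee : e * e = e) (hωe : ω e = 1) {y : A} (hy : ω y = 0) :
    (2 : K) • (e * (e * y)) = e * y ∧ (e * y) * (y * y) = 0 ∧
      (4 : K) • ((e * y) * (e * y)) + (2 : K) • (e * (y * y)) = y * y := by
  have hyy : (y * y) * (y * y) = 0 := by simpa [hy] using hbern y
  have key (t : K) : t • ((4 : K) • (e * (e * y)) - (2 : K) • (e * y)) +
      t ^ 2 • ((4 : K) • ((e * y) * (e * y)) + (2 : K) • (e * (y * y)) - y * y) +
      t ^ 3 • ((4 : K) • ((e * y) * (y * y))) = 0 := by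
    have h := hbern (e + t • y)
    have hsq : (e + t • y) * (e + t • y) = e + (2 * t) • (e * y) + t ^ 2 • (y * y) := by
      simp only [mul_add, add_mul, smul_mul_assoc, mul_smul_comm, hee, mul_comm y e]
      module
    rw [hsq] at h
    simp only [map_add, map_smul, hy, hωe, smul_zero, add_zero, one_pow, one_smul, mul_add,
      add_mul, smul_mul_assoc, mul_smul_comm, hee, mul_comm (e * y) e, mul_comm (y * y) e,
      mul_comm (y * y) (e * y), hyy] at h
    rw [← sub_eq_zero] at h
    rw [← h]
    module
  have hp := key 1
  have hm := key (-1)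
  have hd := key 2
  generalize hX : (4 : K) • (e * (e * y)) - (2 : K) • (e * y) = X at *
  generalize hY : (4 : K) • ((e * y) * (e * y)) + (2 : K) • (e * (y * y)) - y * y = Y at *
  generalize hZ : (e * y) * (y * y) = Z at *
  have hY0 : Y = 0 := by
    have : (2 : K) • Y = 0 := by linear_combination (norm := module) hp + hm
    exact (smul_eq_zero_iff_right h2).1 this
  subst hY0
  have hZ0 : Z = 0 := by
    have : (2 * 2 * 2 * 3 : K) • Z = 0 := by linear_combination (norm := module) hd - (2 : K) • hp
    exact (smul_eq_zero_iff_right (by simp [h2, h3])).1 this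
  subst hZ0
  refine ⟨(smul_right_injective A h2).eq_iff.1 ?_, rfl, sub_eq_zero.1 hY⟩
  have hX0 : X = 0 := by simpa using hp
  rw [hX0, sub_eq_zero] at hX
  rw [← hX]
  module

theorem hasPeirceDecomposition_of_bernstein (h2 : (2 : K) ≠ 0) (h3 : (3 : K) ≠ 0)
    (hωmul : ∀ x y : A, ω (x * y) = ω x * ω y)
    (hbern : ∀ x : A, (x * x) * (x * x) = ω x ^ 2 • (x * x))
    (hee : e * e = e) (hωe : ω e = 1) : HasPeirceDecomposition ω e := by
  have comp {y : A} (hy : ω y = 0) := bernstein_components h2 h3 hbern hee hωe hy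
  have hU {u : A} (hu : u ∈ peirceHalf K e) : ω u = 0 := by
    have h := congrArg ω (mem_peirceHalf.1 hu)
    rw [map_smul, hωmul, hωe, smul_eq_mul] at h
    linear_combination h
  have hV {v : A} (hv : v ∈ peirceZero K e) : ω v = 0 := by
    have h := congrArg ω (mem_peirceZero.1 hv)
    rwa [hωmul, hωe, map_zero, one_mul] at h
  have bilin {y z : A} (hy : ω y = 0) (hz : ω z = 0) :
      (4 : K) • ((e * y) * (e * z)) + (2 : K) • (e * (y * z)) = y * z := by
    have h := (comp (y := y + z) (by simp [hy, hz])).2.2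
    have h1 := (comp hy).2.2
    have h1' := (comp hz).2.2
    simp only [mul_add, add_mul, mul_comm z y, mul_comm (e * z) (e * y)] at h
    refine (smul_right_injective A h2).eq_iff.1 ?_
    linear_combination (norm := module) h - h1 - h1'
  have uu : ∀ u ∈ peirceHalf K e, ∀ u' ∈ peirceHalf K e, u * u' ∈ peirceZero K e := by
    intro u hu u' hu'
    have h := bilin (hU hu) (hU hu')
    have h1 : (4 : K) • ((e * u) * (e * u')) = u * u' := by
      conv_rhs => rw [← mem_peirceHalf.1 hu, ← mem_peirceHalf.1 hu']
      simp only [smul_mul_assoc, mul_smul_comm]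
      module
    rw [h1, add_eq_left] at h
    exact (smul_eq_zero_iff_right h2).1 h
  have uv : ∀ u ∈ peirceHalf K e, ∀ v ∈ peirceZero K e, u * v ∈ peirceHalf K e := by
    intro u hu v hv
    have h := bilin (hU hu) (hV hv)
    rwa [mem_peirceZero.1 hv, mul_zero, smul_zero, zero_add] at h
  have vv : ∀ v ∈ peirceZero K e, ∀ v' ∈ peirceZero K e, v * v' ∈ peirceHalf K e := by
    intro v hv v' hv'
    have h := bilin (hV hv) (hV hv')
    rwa [mem_peirceZero.1 hv, zero_mul, smul_zero, zero_add] at h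
  have cubic {u v : A} (hu : u ∈ peirceHalf K e) (hv : v ∈ peirceZero K e) :
      (2 : K) • (u * (u * v)) + u * (v * v) = 0 := by
    have h := (comp (y := u + v) (by simp [hU hu, hV hv])).2.1
    rw [mul_add, mem_peirceZero.1 hv, add_zero] at h
    have h' : u * (u * u) + ((2 : K) • (u * (u * v)) + u * (v * v)) = 0 := by
      refine Eq.trans ?_ ((congrArg ((2 : K) • ·) h).trans (smul_zero _))
      rw [← smul_mul_assoc _ (e * u), mem_peirceHalf.1 hu]
      simp only [mul_add, add_mul, mul_comm v u]
      module
    have hVmem : (2 : K) • (u * (u * v)) + u * (v * v) ∈ peirceZero K e :=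
      add_mem (Submodule.smul_mem _ _ (uu u hu _ (uv u hu v hv))) (uu u hu _ (vv v hv v hv))
    have hUmem : u * (u * u) ∈ peirceHalf K e := uv u hu _ (uu u hu u hu)
    have h0 : u * (u * u) = 0 := by
      refine eq_zero_of_mem_peirceHalf_of_mem_peirceZero hUmem ?_
      rw [eq_neg_of_add_eq_zero_left h']
      exact neg_mem hVmem
    rwa [h0, zero_add] at h'
  have uvv {u v : A} (hu : u ∈ peirceHalf K e) (hv : v ∈ peirceZero K e) : u * (v * v) = 0 := by
    have h := cubic hu hv
    have h' := cubic hu (neg_mem hv)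
    simp only [mul_neg, neg_mul, neg_neg] at h'
    refine (smul_eq_zero_iff_right h2).1 ?_
    linear_combination (norm := module) h + h'
  have uuv {u v : A} (hu : u ∈ peirceHalf K e) (hv : v ∈ peirceZero K e) : u * (u * v) = 0 := by
    have h := cubic hu hv
    rw [uvv hu hv, add_zero] at h
    exact (smul_eq_zero_iff_right h2).1 h
  refine ⟨hωe, ?_, fun u hu => hU hu, fun v hv => hV hv, uu, uv, vv, ?_, ?_⟩
  · intro x hx
    have h := (comp (LinearMap.mem_ker.1 hx)).1
    refine ⟨(2 : K) • (e * x), ?_, x - (2 : K) • (e * x), ?_, by abel⟩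
    · rw [mem_peirceHalf, mul_smul_comm, h]
    · rw [mem_peirceZero, mul_sub, mul_smul_comm, h, sub_self]
  · intro u hu v hv v' hv'
    have h := uvv hu (add_mem hv hv')
    simp only [mul_add, add_mul, uvv hu hv, uvv hu hv', mul_comm v' v, zero_add, add_zero] at h
    refine (smul_eq_zero_iff_right h2).1 ?_
    rw [two_smul, h]
  · intro u hu u' hu' v hv
    have h := uuv (add_mem hu hu') hv
    simp only [mul_add, add_mul, uuv hu hv, uuv hu' hv, zero_add, add_zero] at h
    rw [mul_comm v u', mul_comm (u * v) u']
    exact eq_neg_of_add_eq_zero_right h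

end Identities

section Ideals

variable {ω : A →ₗ[K] K} {e : A}

/-- A subspace stable under multiplication by `e`, `U` and `V` is an ideal. -/
theorem HasPeirceDecomposition.mul_mem [IsScalarTower K A A]
    (he : HasPeirceDecomposition ω e) {x : A} {S : Submodule K A}
    (hxe : e * x ∈ S) (hxU : ∀ u ∈ peirceHalf K e, u * x ∈ S)
    (hxV : ∀ v ∈ peirceZero K e, v * x ∈ S) (a : A) : a * x ∈ S := by
  obtain ⟨u, hu, v, hv, huv⟩ := he.exists_add (a - ω a • e) (by simp [he.weight])
  have ha : a = ω a • e + (u + v) := by rw [huv]; abel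
  rw [ha, add_mul, add_mul]
  refine add_mem ?_ (add_mem (hxU u hu) (hxV v hv))
  rw [smul_mul_assoc]
  exact S.smul_mem _ hxe

/-- The homogeneous part `(J ∩ U) + (J ∩ V)` of a subspace `J`. -/
def homogeneousPart (e : A) (J : Submodule K A) : Submodule K A :=
  (J ⊓ peirceHalf K e) ⊔ (J ⊓ peirceZero K e)

theorem homogeneousPart_mono {J J' : Submodule K A} (h : J ≤ J') :
    homogeneousPart e J ≤ homogeneousPart e J' :=
  sup_le_sup (inf_le_inf_right _ h) (inf_le_inf_right _ h)

theorem homogeneousPart_le (J : Submodule K A) : homogeneousPart e J ≤ J :=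
  sup_le inf_le_left inf_le_left

theorem HasPeirceDecomposition.mul_mem_homogeneousPart [IsScalarTower K A A]
    (he : HasPeirceDecomposition ω e) (h2 : (2 : K) ≠ 0) {J : Submodule K A}
    (hJ : ∀ a ∈ LinearMap.ker ω, ∀ x ∈ J, a * x ∈ J) (a : A) {x : A}
    (hx : x ∈ homogeneousPart e J) : a * x ∈ homogeneousPart e J := by
  obtain ⟨w, ⟨hwJ, hw⟩, b, ⟨hbJ, hb⟩, rfl⟩ := Submodule.mem_sup.1 hx
  have inU {y : A} (h : y ∈ J) (h' : y ∈ peirceHalf K e) : y ∈ homogeneousPart e J :=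
    Submodule.mem_sup_left ⟨h, h'⟩
  have inV {y : A} (h : y ∈ J) (h' : y ∈ peirceZero K e) : y ∈ homogeneousPart e J :=
    Submodule.mem_sup_right ⟨h, h'⟩
  rw [mul_add]
  refine add_mem (he.mul_mem ?_ (fun u hu => ?_) (fun v hv => ?_) a)
    (he.mul_mem ?_ (fun u hu => ?_) (fun v hv => ?_) a)
  · exact mul_mem_of_mem_peirceHalf h2 hw (inU hwJ hw)
  · exact inV (hJ u (he.half_le hu) w hwJ) (he.half_mul_half u hu w hw)
  · exact inU (hJ v (he.zero_le hv) w hwJ) (mul_comm w v ▸ he.half_mul_zero w hw v hv)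
  · rw [mem_peirceZero.1 hb]
    exact zero_mem _
  · exact inU (hJ u (he.half_le hu) b hbJ) (he.half_mul_zero u hu b hb)
  · exact inU (hJ v (he.zero_le hv) b hbJ) (he.zero_mul_zero v hv b hb)

/-- The projection of `J ∩ (U + V)` to `V`. -/
def zeroProjection (e : A) (J : Submodule K A) : Submodule K A :=
  (J ⊔ peirceHalf K e) ⊓ peirceZero K e

theorem mem_zeroProjection {J : Submodule K A} {b : A} :
    b ∈ zeroProjection e J ↔ b ∈ peirceZero K e ∧ ∃ a ∈ peirceHalf K e, a + b ∈ J := by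
  rw [zeroProjection, Submodule.mem_inf, and_comm, Submodule.mem_sup]
  refine and_congr_right fun _ => ⟨?_, ?_⟩
  · rintro ⟨y, hy, u, hu, rfl⟩
    exact ⟨-u, neg_mem hu, by simpa using hy⟩
  · rintro ⟨a, ha, hab⟩
    exact ⟨a + b, hab, -a, neg_mem ha, by abel⟩

theorem zeroProjection_mono {J J' : Submodule K A} (h : J ≤ J') :
    zeroProjection e J ≤ zeroProjection e J' :=
  inf_le_inf_right _ (sup_le_sup_right h _)

/-- The elements `w` of `U` such that `U w` lies in the projection of `J` to `V` and `(U V) w`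
lies in `J`. -/
def halfTransporter (e : A) (J : Submodule K A) : Submodule K A where
  carrier := {w | w ∈ peirceHalf K e ∧ (∀ u ∈ peirceHalf K e, u * w ∈ zeroProjection e J) ∧
    ∀ u ∈ peirceHalf K e, ∀ v ∈ peirceZero K e, (u * v) * w ∈ J}
  add_mem' := by
    rintro a b ⟨ha, ha', ha''⟩ ⟨hb, hb', hb''⟩
    refine ⟨add_mem ha hb, fun u hu => ?_, fun u hu v hv => ?_⟩ <;> rw [mul_add]
    · exact add_mem (ha' u hu) (hb' u hu)
    · exact add_mem (ha'' u hu v hv) (hb'' u hu v hv)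
  zero_mem' := by simp
  smul_mem' := by
    rintro c a ⟨ha, ha', ha''⟩
    refine ⟨Submodule.smul_mem _ c ha, fun u hu => ?_, fun u hu v hv => ?_⟩ <;>
      rw [mul_smul_comm]
    · exact Submodule.smul_mem _ c (ha' u hu)
    · exact Submodule.smul_mem _ c (ha'' u hu v hv)

theorem mem_halfTransporter {J : Submodule K A} {w : A} :
    w ∈ halfTransporter e J ↔ w ∈ peirceHalf K e ∧
      (∀ u ∈ peirceHalf K e, u * w ∈ zeroProjection e J) ∧
      ∀ u ∈ peirceHalf K e, ∀ v ∈ peirceZero K e, (u * v) * w ∈ J := Iff.rfl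

/-- For an ideal `J` of the barideal, an ideal of the whole algebra that meets `V` exactly in the
projection of `J` to `V`. -/
def projectionHull (e : A) (J : Submodule K A) : Submodule K A :=
  halfTransporter e J ⊔ zeroProjection e J

theorem projectionHull_mono {J J' : Submodule K A} (h : J ≤ J') :
    projectionHull e J ≤ projectionHull e J' :=
  sup_le_sup (fun _ hw => ⟨hw.1, fun u hu => zeroProjection_mono h (hw.2.1 u hu),
    fun u hu v hv => h (hw.2.2 u hu v hv)⟩) (zeroProjection_mono h)

theorem mem_zeroProjection_of_mem_projectionHull {J : Submodule K A} {b : A}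
    (hb : b ∈ projectionHull e J) (hbV : b ∈ peirceZero K e) : b ∈ zeroProjection e J := by
  obtain ⟨w, hw, q, hq, rfl⟩ := Submodule.mem_sup.1 hb
  have hwV : w ∈ peirceZero K e := by simpa using sub_mem hbV hq.2
  rwa [eq_zero_of_mem_peirceHalf_of_mem_peirceZero hw.1 hwV, zero_add]

namespace HasPeirceDecomposition

theorem mem_halfTransporter_of_add_mem (he : HasPeirceDecomposition ω e) {J : Submodule K A}
    (hJ : ∀ a ∈ LinearMap.ker ω, ∀ x ∈ J, a * x ∈ J) {a b : A}
    (ha : a ∈ peirceHalf K e) (hb : b ∈ peirceZero K e) (hab : a + b ∈ J) :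
    a ∈ halfTransporter e J := by
  refine ⟨ha, fun u hu => ?_, fun u hu v hv => ?_⟩
  · refine mem_zeroProjection.2 ⟨he.half_mul_half u hu a ha, u * b, he.half_mul_zero u hu b hb, ?_⟩
    rw [add_comm, ← mul_add]
    exact hJ u (he.half_le hu) _ hab
  · have h := hJ u (he.half_le hu) _ (hJ v (he.zero_le hv) _ hab)
    rw [mul_add, mul_add, he.half_mul_zero_mul_zero u hu v hv b hb, add_zero,
      he.half_mul_half_mul_zero u hu a ha v hv] at h
    exact neg_mem_iff.1 h

theorem zero_mul_mem_halfTransporter (he : HasPeirceDecomposition ω e) {J : Submodule K A} {v w : A}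
    (hv : v ∈ peirceZero K e) (hw : w ∈ halfTransporter e J) : v * w ∈ halfTransporter e J := by
  obtain ⟨hwU, hw1, hw2⟩ := hw
  refine ⟨mul_comm w v ▸ he.half_mul_zero w hwU v hv, fun u hu => ?_, fun u hu v' hv' => ?_⟩
  · have huv := he.half_mul_zero u hu v hv
    rw [he.half_mul_half_mul_zero u hu w hwU v hv]
    exact neg_mem (hw1 _ huv)
  · have huv := he.half_mul_zero u hu v' hv'
    rw [he.half_mul_half_mul_zero _ huv w hwU v hv]
    exact neg_mem (hw2 _ huv v hv)

theorem mul_mem_projectionHull [IsScalarTower K A A] (he : HasPeirceDecomposition ω e)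
    (h2 : (2 : K) ≠ 0) {J : Submodule K A} (hJ : ∀ a ∈ LinearMap.ker ω, ∀ x ∈ J, a * x ∈ J)
    (a : A) {x : A} (hx : x ∈ projectionHull e J) : a * x ∈ projectionHull e J := by
  obtain ⟨w, hw, b, hb, rfl⟩ := Submodule.mem_sup.1 hx
  obtain ⟨hbV, c, hc, hcb⟩ := mem_zeroProjection.1 hb
  have hcW := he.mem_halfTransporter_of_add_mem hJ hc hbV hcb
  rw [mul_add]
  refine add_mem (he.mul_mem ?_ (fun u hu => ?_) (fun v hv => ?_) a)
    (he.mul_mem ?_ (fun u hu => ?_) (fun v hv => ?_) a)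
  · exact mul_mem_of_mem_peirceHalf h2 hw.1 (Submodule.mem_sup_left hw)
  · exact Submodule.mem_sup_right (hw.2.1 u hu)
  · exact Submodule.mem_sup_left (he.zero_mul_mem_halfTransporter hv hw)
  · rw [mem_peirceZero.1 hbV]
    exact zero_mem _
  · refine Submodule.mem_sup_left (he.mem_halfTransporter_of_add_mem hJ
      (he.half_mul_zero u hu b hbV) (he.half_mul_half u hu c hc) ?_)
    rw [add_comm, ← mul_add]
    exact hJ u (he.half_le hu) _ hcb
  · have hsum : v * c + v * b ∈ J := mul_add v c b ▸ hJ v (he.zero_le hv) _ hcb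
    have hU : v * c + v * b ∈ peirceHalf K e :=
      add_mem (mul_comm c v ▸ he.half_mul_zero c hc v hv) (he.zero_mul_zero v hv b hbV)
    have h := sub_mem (he.mem_halfTransporter_of_add_mem hJ hU (zero_mem _) (by simpa using hsum))
      (he.zero_mul_mem_halfTransporter hv hcW)
    rw [add_sub_cancel_left] at h
    exact Submodule.mem_sup_left h

/-- An inclusion of subspaces of the barideal is an equality as soon as homogeneous parts and
projection hulls agree. -/
theorem le_of_homogeneousPart_le_of_projectionHull_le (he : HasPeirceDecomposition ω e)
    {J J' : Submodule K A} (hJ' : J' ≤ LinearMap.ker ω) (hle : J ≤ J')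
    (hh : homogeneousPart e J' ≤ homogeneousPart e J)
    (hp : projectionHull e J' ≤ projectionHull e J) : J' ≤ J := by
  intro x hx
  obtain ⟨u, hu, v, hv, rfl⟩ := he.exists_add x (hJ' hx)
  have hvJ : v ∈ zeroProjection e J := mem_zeroProjection_of_mem_projectionHull
    (hp (Submodule.mem_sup_right (mem_zeroProjection.2 ⟨hv, u, hu, hx⟩))) hv
  obtain ⟨-, u', hu', hx'⟩ := mem_zeroProjection.1 hvJ
  have hd : u - u' ∈ J := by
    refine homogeneousPart_le J (hh (Submodule.mem_sup_left ⟨?_, sub_mem hu hu'⟩))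
    simpa using sub_mem hx (hle hx')
  have h := add_mem hd hx'
  rwa [← add_assoc, sub_add_cancel] at h

end HasPeirceDecomposition

end Ideals

end PeirceDecomposition

/-- A submodule is determined, among larger submodules, by its intersection with the kernel of a
linear functional and by whether the functional vanishes on it. -/
theorem Submodule.le_of_inf_ker_le {K M : Type*} [Field K] [AddCommGroup M] [Module K M]
    {ω : M →ₗ[K] K} {S T : Submodule K M} (hST : S ≤ T)
    (hker : T ⊓ LinearMap.ker ω ≤ S) (hω : T ≤ LinearMap.ker ω ∨ ¬ S ≤ LinearMap.ker ω) :
    T ≤ S := by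
  rcases hω with hT | hS
  · rwa [inf_eq_left.2 hT] at hker
  · obtain ⟨s, hs, hωs⟩ := SetLike.not_le_iff_exists.1 hS
    rw [LinearMap.mem_ker] at hωs
    intro t ht
    have h : t - (ω t / ω s) • s ∈ S := hker ⟨sub_mem ht (T.smul_mem _ (hST hs)), by simp [hωs]⟩
    simpa using add_mem h (S.smul_mem (ω t / ω s) hs)

/-- A Bernstein algebra `A` over a field `K` of characteristic `≠ 2, 3` is
Noetherian (satisfies the a.c.c. on ideals of `A`) if and only if its barideal `N = ker ω` is
Noetherian (satisfies the a.c.c. on ideals of `N`, i.e. on subspaces `I ⊆ N` with `NI ⊆ I`). -/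
theorem bernstein_noetherian_iff_barideal_noetherian {K A : Type*} [Field K]
    [NonUnitalNonAssocCommRing A] [Module K A] [SMulCommClass K A A] [IsScalarTower K A A]
    (h2 : (2 : K) ≠ 0) (h3 : (3 : K) ≠ 0)
    (ω : A →ₗ[K] K) (hωmul : ∀ x y : A, ω (x * y) = ω x * ω y) (hω0 : ω ≠ 0)
    (hbern : ∀ x : A, (x * x) * (x * x) = ω x ^ 2 • (x * x)) :
    -- `A` is Noetherian: every ascending chain of ideals of `A` stabilizes
    (∀ f : ℕ → Submodule K A, (∀ k, ∀ a : A, ∀ x ∈ f k, a * x ∈ f k) → Monotone f →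
      ∃ n, ∀ m, n ≤ m → f m = f n) ↔
    -- `N = ker ω` is Noetherian: every ascending chain of ideals of `N` stabilizes
    (∀ f : ℕ → Submodule K A, (∀ k, f k ≤ LinearMap.ker ω) →
      (∀ k, ∀ a ∈ LinearMap.ker ω, ∀ x ∈ f k, a * x ∈ f k) → Monotone f →
      ∃ n, ∀ m, n ≤ m → f m = f n) := by
  constructor
  · intro hA f hfN hf hmono
    obtain ⟨x, hx⟩ := DFunLike.ne_iff.1 hω0
    have hx' : ω ((ω x)⁻¹ • x) = 1 := by simpa using inv_mul_cancel₀ hx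
    set y := (ω x)⁻¹ • x
    have he : HasPeirceDecomposition ω (y * y) :=
      hasPeirceDecomposition_of_bernstein h2 h3 hωmul hbern (by simpa [hx'] using hbern y)
        (by rw [hωmul, hx', one_mul])
    obtain ⟨n₁, hn₁⟩ := hA (fun k => homogeneousPart (y * y) (f k))
      (fun k a x hx => he.mul_mem_homogeneousPart h2 (hf k) a hx)
      (fun i j hij => homogeneousPart_mono (hmono hij))
    obtain ⟨n₂, hn₂⟩ := hA (fun k => projectionHull (y * y) (f k))
      (fun k a x hx => he.mul_mem_projectionHull h2 (hf k) a hx)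
      (fun i j hij => projectionHull_mono (hmono hij))
    refine ⟨max n₁ n₂, fun m hm => le_antisymm ?_ (hmono hm)⟩
    refine he.le_of_homogeneousPart_le_of_projectionHull_le (hfN m) (hmono hm) ?_ ?_
    · exact ((hn₁ m (by omega)).trans (hn₁ _ (by omega)).symm).le
    · exact ((hn₂ m (by omega)).trans (hn₂ _ (by omega)).symm).le
  · intro hN f hf hmono
    obtain ⟨n₁, hn₁⟩ := hN (fun k => f k ⊓ LinearMap.ker ω) (fun k => inf_le_right)
      (fun k a _ x hx => ⟨hf k a x hx.1, by
        rw [SetLike.mem_coe, LinearMap.mem_ker, hωmul, LinearMap.mem_ker.1 hx.2, mul_zero]⟩)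
      (fun i j hij => inf_le_inf_right _ (hmono hij))
    have hker {n m : ℕ} (hn : n₁ ≤ n) (hm : n ≤ m) : f m ⊓ LinearMap.ker ω ≤ f n :=
      ((hn₁ m (hn.trans hm)).trans (hn₁ n hn).symm).le.trans inf_le_left
    by_cases h : ∀ k, f k ≤ LinearMap.ker ω
    · exact ⟨n₁, fun m hm => le_antisymm
        (Submodule.le_of_inf_ker_le (hmono hm) (hker le_rfl hm) (Or.inl (h m))) (hmono hm)⟩
    · push Not at h
      obtain ⟨k, hk⟩ := h
      exact ⟨max n₁ k, fun m hm => le_antisymm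
        (Submodule.le_of_inf_ker_le (hmono hm) (hker (le_max_left _ _) hm)
          (Or.inr fun h => hk ((hmono (le_max_right _ _)).trans h))) (hmono hm)⟩
end

section
/- Let A be a nuclear Bernstein algebra over a field K of characteristic ≠ 2, 3, i.e. a Bernstein algebra with A² = A, where A² is the linear span of all products xy with x, y ∈ A. Then the barideal N = ker(ω) is locally nilpotent. -/
/-- The product of two subspaces of a (possibly non-associative, non-unital) algebra:
the linear span of all products `x * y` with `x ∈ M`, `y ∈ N`. -/
def subMul {K A : Type*} [Field K] [NonUnitalNonAssocRing A] [Module K A]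
    [SMulCommClass K A A] [IsScalarTower K A A]
    (M N : Submodule K A) : Submodule K A :=
  Submodule.map₂ (LinearMap.mul K A) M N

/-- The powers `Sⁱ` of a subspace `S`, defined (for `i ≥ 1`) by `S¹ = S` and
`Sⁱ = Σ_{r+s=i, r,s ≥ 1} Sʳ Sˢ`.  (We set `S⁰ = S`, an irrelevant junk value.) -/
def algPow {K A : Type*} [Field K] [NonUnitalNonAssocRing A] [Module K A]
    [SMulCommClass K A A] [IsScalarTower K A A]
    (S : Submodule K A) : ℕ → Submodule K A
  | 0 => S
  | 1 => S
  | n + 2 => ⨆ r : Fin (n + 1), subMul (algPow S (r + 1)) (algPow S (n + 1 - r))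
  decreasing_by
  · omega
  · omega

section Nilpotency

variable {K A : Type*} [Field K] [NonUnitalNonAssocCommRing A] [Module K A]
  [SMulCommClass K A A] [IsScalarTower K A A]

theorem mul_mem_subMul {M N : Submodule K A} {x y : A} (hx : x ∈ M) (hy : y ∈ N) :
    x * y ∈ subMul M N :=
  Submodule.apply_mem_map₂ (LinearMap.mul K A) hx hy

theorem subMul_le {M N P : Submodule K A} :
    subMul M N ≤ P ↔ ∀ x ∈ M, ∀ y ∈ N, x * y ∈ P :=
  Submodule.map₂_le

theorem subMul_mono {M M' N N' : Submodule K A} (hM : M ≤ M') (hN : N ≤ N') :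
    subMul M N ≤ subMul M' N' :=
  Submodule.map₂_le_map₂ hM hN

theorem monotone_iterate_subMul (S : Submodule K A) (n : ℕ) : Monotone (subMul S)^[n] :=
  Monotone.iterate (fun _ _ h => subMul_mono le_rfl h) n

theorem algPow_le_of_mul_mem {S S' : Submodule K A} (hSS' : S ≤ S')
    (hS' : ∀ x ∈ S', ∀ y ∈ S', x * y ∈ S') (i : ℕ) : algPow S i ≤ S' := by
  induction i using Nat.strong_induction_on with
  | _ i ih =>
    match i with
    | 0 => rwa [algPow]
    | 1 => rwa [algPow]
    | k + 2 =>
      rw [algPow]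
      refine iSup_le fun r => subMul_le.2 fun x hx y hy => hS' _ ?_ _ ?_
      · exact ih (r + 1) (by omega) hx
      · exact ih (k + 1 - r) (by omega) hy

theorem algPow_le_iterate_subMul {S S' : Submodule K A} (hSS' : S ≤ S')
    (hS' : ∀ x ∈ S', ∀ y ∈ S', x * y ∈ S') (n : ℕ) :
    ∀ i, 2 ^ n ≤ i → algPow S i ≤ (subMul S')^[n] S' := by
  induction n with
  | zero => exact fun i _ => algPow_le_of_mul_mem hSS' hS' i
  | succ n ih =>
    intro i hi
    have hpow : 2 ^ (n + 1) = 2 ^ n + 2 ^ n := by ring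
    have hpos : 0 < 2 ^ n := by positivity
    obtain ⟨k, rfl⟩ : ∃ k, i = k + 2 := ⟨i - 2, by omega⟩
    rw [algPow, Function.iterate_succ_apply']
    refine iSup_le fun r => subMul_le.2 fun x hx y hy => ?_
    rcases le_or_gt (2 ^ n) (k + 1 - (r : ℕ)) with h | h
    · exact mul_mem_subMul (algPow_le_of_mul_mem hSS' hS' _ hx) (ih _ h hy)
    · rw [mul_comm]
      exact mul_mem_subMul (algPow_le_of_mul_mem hSS' hS' _ hy) (ih _ (by omega) hx)

/-- Repeated left multiplication by `S` eventually maps `X` into `Y`. -/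
def EventuallyMaps (S X Y : Submodule K A) : Prop := ∃ n, (subMul S)^[n] X ≤ Y

theorem EventuallyMaps.trans {S X Y Z : Submodule K A} (h₁ : EventuallyMaps S X Y)
    (h₂ : EventuallyMaps S Y Z) : EventuallyMaps S X Z := by
  obtain ⟨m, hm⟩ := h₁
  obtain ⟨n, hn⟩ := h₂
  refine ⟨n + m, ?_⟩
  rw [Function.iterate_add_apply]
  exact (monotone_iterate_subMul S n hm).trans hn

/-- If finitely many elements act on `X` by operators that anticommute modulo `Y`, and `S` maps
`X` into `Y`, then long products of all these operators map `X` into `Y`. -/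
theorem eventuallyMaps_of_anticommute (h2 : (2 : K) ≠ 0) (T : Finset A) :
    ∀ S X Y : Submodule K A, Y ≤ X → (∀ s ∈ S, ∀ x ∈ X, s * x ∈ Y) →
      (∀ t ∈ T, ∀ x ∈ X, t * x ∈ X) → (∀ t ∈ T, ∀ x ∈ Y, t * x ∈ Y) →
      (∀ t ∈ T, ∀ t' ∈ T, ∀ x ∈ X, t * (t' * x) + t' * (t * x) ∈ Y) →
      EventuallyMaps (S ⊔ Submodule.span K (T : Set A)) X Y := by
  classical
  induction T using Finset.induction_on with
  | empty =>
    intro S X Y _ hS _ _ _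
    exact ⟨1, by simpa using subMul_le.2 hS⟩
  | insert t T _ ih =>
    intro S X Y hYX hS hX hY hanti
    have ht : t ∈ insert t T := Finset.mem_insert_self t T
    have hT : ∀ s ∈ T, s ∈ insert t T := fun s hs => Finset.mem_insert_of_mem hs
    set Z : Submodule K A := Y ⊔ X.map (LinearMap.mulLeft K t) with hZ
    have hYZ : Y ≤ Z := le_sup_left
    have htZ : ∀ x ∈ X, t * x ∈ Z := fun x hx =>
      (le_sup_right : _ ≤ Z) (Submodule.mem_map_of_mem (f := LinearMap.mulLeft K t) hx)
    have hZX : Z ≤ X := by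
      refine sup_le hYX ?_
      rintro _ ⟨x, hx, rfl⟩
      exact hX t ht x hx
    have hTZ : ∀ s ∈ T, ∀ x ∈ Z, s * x ∈ Z := by
      intro s hs x hx
      obtain ⟨y, hy, _, ⟨x', hx', rfl⟩, rfl⟩ := Submodule.mem_sup.1 hx
      have h := hYZ (hanti s (hT s hs) t ht x' hx')
      rw [LinearMap.mulLeft_apply, mul_add]
      refine Z.add_mem (hYZ (hY s (hT s hs) y hy)) ?_
      simpa using Z.sub_mem h (htZ _ (hX s (hT s hs) x' hx'))
    have htZY : ∀ x ∈ Z, t * x ∈ Y := by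
      intro x hx
      obtain ⟨y, hy, _, ⟨x', hx', rfl⟩, rfl⟩ := Submodule.mem_sup.1 hx
      have h := hanti t ht t ht x' hx'
      rw [← two_smul K, Submodule.smul_mem_iff _ h2] at h
      rw [LinearMap.mulLeft_apply, mul_add]
      exact Y.add_mem (hY t ht y hy) h
    have hspan : S ⊔ Submodule.span K ((insert t T : Finset A) : Set A) =
        (S ⊔ Submodule.span K {t}) ⊔ Submodule.span K (T : Set A) := by
      rw [Finset.coe_insert, Submodule.span_insert, sup_assoc]
    rw [hspan]
    refine EventuallyMaps.trans (Y := Z) (ih _ X Z hZX ?_ ?_ hTZ ?_) (ih _ Z Y hYZ ?_ hTZ ?_ ?_)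
    · intro s hs x hx
      obtain ⟨s', hs', _, h, rfl⟩ := Submodule.mem_sup.1 hs
      obtain ⟨c, rfl⟩ := Submodule.mem_span_singleton.1 h
      rw [add_mul, smul_mul_assoc]
      exact Z.add_mem (hYZ (hS s' hs' x hx)) (Z.smul_mem c (htZ x hx))
    · exact fun s hs => hX s (hT s hs)
    · exact fun s hs s' hs' x hx => hYZ (hanti s (hT s hs) s' (hT s' hs') x hx)
    · intro s hs x hx
      obtain ⟨s', hs', _, h, rfl⟩ := Submodule.mem_sup.1 hs
      obtain ⟨c, rfl⟩ := Submodule.mem_span_singleton.1 h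
      rw [add_mul, smul_mul_assoc]
      exact Y.add_mem (hS s' hs' x (hZX hx)) (Y.smul_mem c (htZY x hx))
    · exact fun s hs => hY s (hT s hs)
    · exact fun s hs s' hs' x hx => hanti s (hT s hs) s' (hT s' hs') x (hZX hx)

end Nilpotency

section AnticommutingOperators

/-- The operator identity behind the nilpotency of the barideal. -/
theorem anticommuting_quadruple_eq_zero {ι E : Type*} [Ring E]
    (hE : ∀ x : E, 2 * x = 0 → x = 0) (r : ι → E) (δ : ι → ι) (q : ι → ι → ι) (t₁ t₂ : E) (s : ι)
    (hr : ∀ v w, r v * r w = -(r w * r v)) (ht : t₁ + t₂ = -r s)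
    (hδ : ∀ v, t₁ * r v + r v * t₂ = r (δ v))
    (hq : ∀ v w, t₁ * (r v * r w) - r v * r w * t₂ = r (q v w)) (x y z w : ι) :
    r (δ x) * r y * r z * r w = 0 := by
  obtain ⟨τ, hτ⟩ : ∃ τ, τ = t₁ - t₂ := ⟨_, rfl⟩
  have ht₁ : 2 * t₁ = τ - r s := by
    rw [hτ, sub_eq_add_neg (t₁ - t₂), ← ht]; noncomm_ring
  have ht₂ : 2 * t₂ = -τ - r s := by
    rw [hτ, sub_eq_add_neg (-(t₁ - t₂)), ← ht]; noncomm_ring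
  have hcomm : ∀ v, τ * r v = r v * τ + 2 * r (δ v) := by
    intro v
    have h : 2 * r (δ v) = 2 * t₁ * r v + r v * (2 * t₂) := by rw [← hδ]; noncomm_ring
    rw [h, ht₁, ht₂, sub_mul, hr s v]; noncomm_ring
  have hpair : ∀ v w, τ * (r v * r w) + r v * r w * τ = 2 * r (q v w) := by
    intro v w
    have h : 2 * r (q v w) = 2 * t₁ * (r v * r w) - r v * r w * (2 * t₂) := by
      rw [← hq]; noncomm_ring
    have hs : r s * (r v * r w) = r v * r w * r s := by
      rw [← mul_assoc, hr s v, mul_assoc, neg_mul, mul_assoc, hr s w]; noncomm_ring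
    rw [h, ht₁, ht₂, sub_mul, hs]; noncomm_ring
  have hrrr : ∀ v w x, r x * (r v * r w) = r v * r w * r x := by
    intro v w x
    rw [← mul_assoc, hr x v, neg_mul, mul_assoc, hr x w]; noncomm_ring
  have htriple : ∀ v w x, τ * (r v * r w * r x) = -(r v * r w * r x * τ) := by
    intro v w x
    have h : 2 * r (q v w) * r x + r x * (2 * r (q v w)) = 0 := by
      rw [mul_assoc, hr (q v w) x]; noncomm_ring
    rw [← hpair] at h
    have h1 : r v * r w * τ * r x = r v * r w * r x * τ + 2 * (r v * r w * r (δ x)) := by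
      rw [mul_assoc, hcomm]; noncomm_ring
    have h2 : r x * (τ * (r v * r w)) = τ * (r v * r w * r x) - 2 * (r v * r w * r (δ x)) := by
      rw [← hrrr v w x, ← hrrr v w (δ x), ← mul_assoc τ (r x), hcomm x]; noncomm_ring
    have h3 : r x * (r v * r w * τ) = r v * r w * r x * τ := by
      rw [← hrrr v w x]; noncomm_ring
    rw [add_mul, mul_add, h1, h2, h3] at h
    refine eq_neg_of_add_eq_zero_left (hE _ ?_)
    rw [← h]; noncomm_ring
  have hshift : ∀ a b c d, r (δ a) * r b * r c * r d = -(r a * r b * r c * r (δ d)) := by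
    intro a b c d
    have h1 : τ * (r a * r b * r c * r d) =
        -(r a * r b * r c * r d * τ) - 2 * (r a * r b * r c * r (δ d)) := by
      rw [← mul_assoc, htriple, neg_mul, mul_assoc, hcomm]; noncomm_ring
    have h2 : τ * (r a * r b * r c * r d) =
        -(r a * r b * r c * r d * τ) + 2 * (r (δ a) * r b * r c * r d) := by
      rw [show r a * r b * r c * r d = r a * (r b * r c * r d) by noncomm_ring, ← mul_assoc τ,
        hcomm, add_mul, mul_assoc (r a) τ, htriple]
      noncomm_ring
    refine eq_neg_of_add_eq_zero_left (hE _ ?_)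
    calc _ = (-(r a * r b * r c * r d * τ) + 2 * (r (δ a) * r b * r c * r d)) -
          (-(r a * r b * r c * r d * τ) - 2 * (r a * r b * r c * r (δ d))) := by
            rw [mul_add]; abel
      _ = 0 := by rw [← h1, ← h2, sub_self]
  have h1 : r (δ x) * r y * r z * r w = -(r x * r y * r (δ z) * r w) := by
    rw [mul_assoc (r (δ x) * r y), hr z w, mul_neg, ← mul_assoc, hshift, mul_assoc (r x * r y),
      hr w (δ z)]
    noncomm_ring
  have h2 : r x * r y * r (δ z) * r w = -(r x * r y * r z * r (δ w)) := by
    rw [← hrrr x y (δ z), ← mul_assoc, hshift, ← hrrr x y z]; noncomm_ring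
  refine hE _ ?_
  rw [two_mul]
  nth_rewrite 1 [h1]
  rw [h2, hshift]; noncomm_ring

end AnticommutingOperators

section Peirce

variable {K A : Type*} [Field K] [NonUnitalNonAssocCommRing A] [Module K A]
  [SMulCommClass K A A] [IsScalarTower K A A]

/-- The multiplication rules of the Peirce components of the barideal of a nuclear Bernstein
algebra. -/
structure IsNuclearPeircePair (U V : Submodule K A) : Prop where
  mul_uu : ∀ a ∈ U, ∀ b ∈ U, a * b ∈ V
  mul_vu : ∀ v ∈ V, ∀ a ∈ U, v * a ∈ U
  mul_vv : ∀ v ∈ V, ∀ w ∈ V, v * w ∈ U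
  jacobi : ∀ a ∈ U, ∀ b ∈ U, ∀ c ∈ U, a * (b * c) + b * (c * a) + c * (a * b) = 0
  skew : ∀ a ∈ U, ∀ b ∈ U, ∀ v ∈ V, a * (v * b) + b * (v * a) = 0
  mul_mul_vv : ∀ a ∈ U, ∀ v ∈ V, ∀ w ∈ V, a * (v * w) = 0
  quartic : ∀ a ∈ U, ∀ b ∈ U, ∀ v ∈ V, ∀ w ∈ V,
    a * b * (v * w) + v * a * (w * b) + w * a * (v * b) = 0
  le_subMul : V ≤ subMul U U

/-- The elements of `U` annihilated by `U`. -/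
def annihilatorIn (U : Submodule K A) : Submodule K A where
  carrier := {x | x ∈ U ∧ ∀ a ∈ U, a * x = 0}
  add_mem' := fun hx hy => ⟨U.add_mem hx.1 hy.1, fun a ha => by
    rw [mul_add, hx.2 a ha, hy.2 a ha, add_zero]⟩
  zero_mem' := ⟨U.zero_mem, fun a _ => mul_zero a⟩
  smul_mem' := fun c x hx => ⟨U.smul_mem c hx.1, fun a ha => by
    rw [mul_smul_comm, hx.2 a ha, smul_zero]⟩

namespace IsNuclearPeircePair

variable {U V : Submodule K A} (h : IsNuclearPeircePair U V)
include h

theorem vv_mem_annihilatorIn {v w : A} (hv : v ∈ V) (hw : w ∈ V) :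
    v * w ∈ annihilatorIn U :=
  ⟨h.mul_vv v hv w hw, fun a ha => h.mul_mul_vv a ha v hv w hw⟩

theorem mul_annihilatorIn {v x : A} (hv : v ∈ V) (hx : x ∈ annihilatorIn U) : v * x = 0 := by
  have hle : subMul U U ≤ LinearMap.ker (LinearMap.mulRight K x) := by
    refine subMul_le.2 fun a ha b hb => ?_
    have hj := h.jacobi x hx.1 a ha b hb
    rw [mul_comm b x, mul_comm x b, hx.2 b hb, mul_comm x a, hx.2 a ha, mul_zero, mul_zero,
      add_zero, add_zero] at hj
    rw [LinearMap.mem_ker, LinearMap.mulRight_apply, mul_comm, hj]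
  exact hle (h.le_subMul hv)

theorem anticommute {v w y : A} (hv : v ∈ V) (hw : w ∈ V) (hy : y ∈ U) :
    v * (w * y) + w * (v * y) ∈ annihilatorIn U := by
  refine ⟨U.add_mem (h.mul_vu v hv _ (h.mul_vu w hw y hy))
    (h.mul_vu w hw _ (h.mul_vu v hv y hy)), fun c hc => ?_⟩
  have h1 := h.skew c hc (w * y) (h.mul_vu w hw y hy) v hv
  have h2 := h.skew c hc (v * y) (h.mul_vu v hv y hy) w hw
  have h3 := h.quartic y hy c hc w hw v hv
  rw [h.mul_annihilatorIn (h.mul_uu y hy c hc) (h.vv_mem_annihilatorIn hw hv), zero_add] at h3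
  rw [mul_add, eq_neg_of_add_eq_zero_left h1, eq_neg_of_add_eq_zero_left h2, ← neg_add, h3,
    neg_zero]

theorem mul_mul_vu_mem {a b v : A} (ha : a ∈ U) (hb : b ∈ U) (hv : v ∈ V) : a * (v * b) ∈ V :=
  h.mul_uu a ha _ (h.mul_vu v hv b hb)

theorem uu_u_mem {a b y : A} (ha : a ∈ U) (hb : b ∈ U) (hy : y ∈ U) : a * (b * y) ∈ U := by
  rw [mul_comm]
  exact h.mul_vu _ (h.mul_uu b hb y hy) a ha

theorem add_swap {a b y : A} (ha : a ∈ U) (hb : b ∈ U) (hy : y ∈ U) :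
    a * (b * y) + b * (a * y) = -(a * b * y) := by
  have := h.jacobi a ha b hb y hy
  rw [mul_comm y a, mul_comm y (a * b)] at this
  exact eq_neg_of_add_eq_zero_left this

theorem mul_commutator {a b x y : A} (ha : a ∈ U) (hb : b ∈ U) (hx : x ∈ V) (hy : y ∈ U) :
    a * (b * (x * y)) + x * (b * (a * y)) - a * (x * b) * y ∈ annihilatorIn U := by
  have hxb := h.mul_vu x hx b hb
  have h1 : b * (x * y) = -(y * (x * b)) := eq_neg_of_add_eq_zero_left (h.skew b hb y hy x hx)
  have h2 := h.jacobi a ha y hy (x * b) hxb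
  have h3 := h.anticommute (h.mul_uu a ha y hy) hx hb
  convert h3 using 1
  rw [h1, mul_neg, mul_comm b (a * y), mul_comm (a * y) (x * b), mul_comm (a * (x * b)) y]
  rw [mul_comm (x * b) a] at h2
  rw [← sub_eq_zero, ← neg_eq_zero, ← h2]
  abel

theorem mul_quadratic {a b v w y : A} (ha : a ∈ U) (hb : b ∈ U) (hv : v ∈ V) (hw : w ∈ V)
    (hy : y ∈ U) :
    a * (b * (v * (w * y))) - v * (w * (b * (a * y))) - a * (v * (w * b)) * y ∈
      annihilatorIn U := by
  have hwb := h.mul_vu w hw b hb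
  have hvwb := h.mul_vu v hv _ hwb
  have hvy := h.mul_vu v hv y hy
  have hz := h.mul_uu a ha y hy
  have h1 : y * (v * (w * b)) = b * (w * (v * y)) := by
    rw [eq_neg_of_add_eq_zero_left (h.skew y hy (w * b) hwb v hv), mul_comm (w * b),
      eq_neg_of_add_eq_zero_left (h.skew (v * y) hvy b hb w hw), neg_neg]
  have h2 : b * (w * (v * y)) = -(b * (v * (w * y))) := by
    rw [eq_neg_iff_add_eq_zero, ← mul_add]
    exact (h.anticommute hw hv hy).2 b hb
  have h3 := h.jacobi a ha (v * (w * b)) hvwb y hy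
  have h4 := h.anticommute hz hv hwb
  have h5 := h.mul_annihilatorIn hv (h.anticommute hz hw hb)
  rw [mul_add] at h5
  rw [mul_comm (v * (w * b)) y, h1, h2, mul_comm y a, mul_comm y] at h3
  convert h4 using 1
  rw [mul_comm b (a * y), eq_neg_of_add_eq_zero_left h5]
  rw [mul_comm (v * (w * b)) (a * y)] at h3
  rw [← sub_eq_zero, ← neg_eq_zero, ← h3, mul_neg]
  abel

theorem quadruple_mem_annihilatorIn (h2 : (2 : K) ≠ 0) {a b x y z w u : A} (ha : a ∈ U)
    (hb : b ∈ U) (hx : x ∈ V) (hy : y ∈ V) (hz : z ∈ V) (hw : w ∈ V) (hu : u ∈ U) :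
    a * (x * b) * (y * (z * (w * u))) ∈ annihilatorIn U := by
  let N : Submodule K U := (annihilatorIn U).comap U.subtype
  let op (f : A →ₗ[K] A) (hf : ∀ x ∈ U, f x ∈ U) (hf' : ∀ x ∈ annihilatorIn U, f x = 0) :
      Module.End K (U ⧸ N) :=
    N.mapQ N (f.restrict hf) fun x hx => by
      have h0 : f.restrict hf x = 0 := Subtype.ext (hf' x hx)
      rw [Submodule.mem_comap, h0]
      exact N.zero_mem
  have hmk : ∀ p q : U, (p : A) - q ∈ annihilatorIn U →
      (Submodule.Quotient.mk p : U ⧸ N) = Submodule.Quotient.mk q :=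
    fun p q hpq => (Submodule.Quotient.eq N).2 hpq
  let r (v : V) : Module.End K (U ⧸ N) := op (LinearMap.mulLeft K v.1)
    (fun p hp => h.mul_vu v v.2 p hp) (fun p hp => h.mul_annihilatorIn v.2 hp)
  let t (c d : U) : Module.End K (U ⧸ N) := op (LinearMap.mulLeft K c.1 ∘ₗ LinearMap.mulLeft K d.1)
    (fun p hp => h.uu_u_mem c.2 d.2 hp)
    (fun p hp => by simp [hp.2 d.1 d.2])
  have key := anticommuting_quadruple_eq_zero (E := Module.End K (U ⧸ N)) (ι := V)
    (fun f hf => by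
      rw [two_mul, ← two_smul K] at hf
      exact (smul_eq_zero.1 hf).resolve_left h2) r
    (fun v => ⟨a * (v * b), h.mul_mul_vu_mem ha hb v.2⟩)
    (fun v w => ⟨a * (v * (w * b)), h.mul_mul_vu_mem ha (h.mul_vu w w.2 b hb) v.2⟩)
    (t ⟨a, ha⟩ ⟨b, hb⟩) (t ⟨b, hb⟩ ⟨a, ha⟩) ⟨a * b, h.mul_uu a ha b hb⟩ ?_ ?_ ?_ ?_
    ⟨x, hx⟩ ⟨y, hy⟩ ⟨z, hz⟩ ⟨w, hw⟩
  · have := LinearMap.congr_fun key (Submodule.Quotient.mk ⟨u, hu⟩)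
    exact (Submodule.Quotient.mk_eq_zero N).1 this
  · intro v w
    refine LinearMap.ext fun m => ?_
    induction m using Submodule.Quotient.induction_on with | _ p => ?_
    refine hmk ⟨_, h.mul_vu v v.2 _ (h.mul_vu w w.2 p p.2)⟩
      (-⟨_, h.mul_vu w w.2 _ (h.mul_vu v v.2 p p.2)⟩) ?_
    simpa using h.anticommute v.2 w.2 p.2
  · refine LinearMap.ext fun m => ?_
    induction m using Submodule.Quotient.induction_on with | _ p => ?_
    refine hmk (⟨_, h.uu_u_mem ha hb p.2⟩ + ⟨_, h.uu_u_mem hb ha p.2⟩)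
      (-⟨_, h.mul_vu _ (h.mul_uu a ha b hb) p p.2⟩) ?_
    have : a * (b * (p : A)) + b * (a * p) - -(a * b * p) = 0 :=
      sub_eq_zero.2 (h.add_swap ha hb p.2)
    change a * (b * (p : A)) + b * (a * p) - -(a * b * p) ∈ _
    rw [this]
    exact Submodule.zero_mem _
  · intro v
    refine LinearMap.ext fun m => ?_
    induction m using Submodule.Quotient.induction_on with | _ p => ?_
    exact hmk (⟨_, h.uu_u_mem ha hb (h.mul_vu v v.2 p p.2)⟩ +
      ⟨_, h.mul_vu v v.2 _ (h.uu_u_mem hb ha p.2)⟩)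
      ⟨_, h.mul_vu _ (h.mul_mul_vu_mem ha hb v.2) p p.2⟩ (h.mul_commutator ha hb v.2 p.2)
  · intro v w
    refine LinearMap.ext fun m => ?_
    induction m using Submodule.Quotient.induction_on with | _ p => ?_
    exact hmk (⟨_, h.uu_u_mem ha hb (h.mul_vu v v.2 _ (h.mul_vu w w.2 p p.2))⟩ -
      ⟨_, h.mul_vu v v.2 _ (h.mul_vu w w.2 _ (h.uu_u_mem hb ha p.2))⟩)
      ⟨_, h.mul_vu _ (h.mul_mul_vu_mem ha (h.mul_vu w w.2 b hb) v.2) p p.2⟩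
      (h.mul_quadratic ha hb v.2 w.2 p.2)

omit h [IsScalarTower K A A] in
theorem annihilatorIn_le : annihilatorIn U ≤ U := fun _ hx => hx.1

omit h in
theorem map_mem_of_mem_subMul {M N R : Submodule K A} (f : A →ₗ[K] A)
    (hf : ∀ m ∈ M, ∀ n ∈ N, f (m * n) ∈ R) {s : A} (hs : s ∈ subMul M N) : f s ∈ R :=
  (subMul_le.2 hf : subMul M N ≤ R.comap f) hs

theorem subMul_subMul_le : subMul U (subMul V U) ≤ V :=
  subMul_le.2 fun a ha _ hx => map_mem_of_mem_subMul (LinearMap.mulLeft K a)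
    (fun _ hv _ hb => h.mul_mul_vu_mem ha hb hv) hx

theorem quadruple_mem_of_mem_subMul (h2 : (2 : K) ≠ 0) {s x : A}
    (hs : s ∈ subMul U (subMul V U)) (hx : x ∈ subMul V (subMul V (subMul V U))) :
    s * x ∈ annihilatorIn U := by
  refine map_mem_of_mem_subMul (LinearMap.mulRight K x) (fun a ha m hm => ?_) hs
  refine map_mem_of_mem_subMul (LinearMap.mulRight K x ∘ₗ LinearMap.mulLeft K a)
    (fun v hv b hb => ?_) hm
  refine map_mem_of_mem_subMul (LinearMap.mulLeft K (a * (v * b))) (fun y hy m hm => ?_) hx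
  refine map_mem_of_mem_subMul (LinearMap.mulLeft K (a * (v * b)) ∘ₗ LinearMap.mulLeft K y)
    (fun z hz m hm => ?_) hm
  exact map_mem_of_mem_subMul
    (LinearMap.mulLeft K (a * (v * b)) ∘ₗ LinearMap.mulLeft K y ∘ₗ LinearMap.mulLeft K z)
    (fun w hw u hu => h.quadruple_mem_annihilatorIn h2 ha hb hv hy hz hw hu) hm

/-- A subspace of `V` which is finite-dimensional modulo `U (V U)` acts nilpotently on `U`,
modulo the annihilator. -/
theorem eventuallyMaps_annihilatorIn (h2 : (2 : K) ≠ 0) (F : Finset A) (hF : ∀ t ∈ F, t ∈ V) :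
    EventuallyMaps (subMul U (subMul V U) ⊔ Submodule.span K (F : Set A)) U (annihilatorIn U) := by
  set Q := subMul U (subMul V U) ⊔ Submodule.span K (F : Set A) with hQ
  have hQV : Q ≤ V := sup_le h.subMul_subMul_le (Submodule.span_le.2 hF)
  have hFQ : ∀ t ∈ F, t ∈ Q := fun t ht =>
    (le_sup_right : _ ≤ Q) (Submodule.subset_span ht)
  have hVU : ∀ {M}, M ≤ U → subMul Q M ≤ U := fun hM =>
    subMul_le.2 fun v hv a ha => h.mul_vu v (hQV hv) a (hM ha)
  have hQ3 : subMul Q (subMul Q (subMul Q U)) ≤ subMul V (subMul V (subMul V U)) :=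
    subMul_mono hQV (subMul_mono hQV (subMul_mono hQV le_rfl))
  have hQ4 : subMul Q (subMul Q (subMul Q (subMul Q U))) ≤ subMul Q (subMul Q (subMul Q U)) :=
    subMul_mono le_rfl (subMul_mono le_rfl (subMul_mono le_rfl (hVU le_rfl)))
  have hXU : subMul Q (subMul Q (subMul Q U)) ⊔ annihilatorIn U ≤ U :=
    sup_le (hVU (hVU (hVU le_rfl))) annihilatorIn_le
  refine EventuallyMaps.trans (Y := subMul Q (subMul Q (subMul Q U)) ⊔ annihilatorIn U)
    ⟨3, le_sup_left⟩ (eventuallyMaps_of_anticommute h2 F _ _ _ le_sup_right ?_ ?_ ?_ ?_)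
  · intro s hs x hx
    obtain ⟨y, hy, z, hz, rfl⟩ := Submodule.mem_sup.1 hx
    rw [mul_add, h.mul_annihilatorIn (h.subMul_subMul_le hs) hz, add_zero]
    exact h.quadruple_mem_of_mem_subMul h2 hs (hQ3 hy)
  · intro t ht x hx
    obtain ⟨y, hy, z, hz, rfl⟩ := Submodule.mem_sup.1 hx
    rw [mul_add, h.mul_annihilatorIn (hF t ht) hz, add_zero]
    exact Submodule.mem_sup_left (hQ4 (mul_mem_subMul (hFQ t ht) hy))
  · intro t ht x hx
    rw [h.mul_annihilatorIn (hF t ht) hx]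
    exact Submodule.zero_mem _
  · exact fun t ht t' ht' x hx => h.anticommute (hF t ht) (hF t' ht') (hXU hx)

theorem mul_mul_iterate_mem {Q : Submodule K A} (hQV : Q ≤ V) (hWQ : subMul U (subMul V U) ≤ Q)
    (j : ℕ) : (subMul Q)^[j] U ≤ U ∧ ∀ a ∈ U, ∀ b ∈ U, ∀ y ∈ (subMul Q)^[j] U,
      a * (b * y) ∈ (subMul Q)^[j] U ⊔ annihilatorIn U := by
  induction j with
  | zero => exact ⟨le_rfl, fun a ha b hb y hy => Submodule.mem_sup_left (h.uu_u_mem ha hb hy)⟩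
  | succ j ih =>
    rw [Function.iterate_succ_apply']
    set M := (subMul Q)^[j] U
    refine ⟨subMul_le.2 fun q hq y hy => h.mul_vu q (hQV hq) y (ih.1 hy), ?_⟩
    intro a ha b hb y hy
    refine map_mem_of_mem_subMul (LinearMap.mulLeft K a ∘ₗ LinearMap.mulLeft K b)
      (fun q hq y hy => ?_) hy
    have h1 := h.mul_commutator ha hb (hQV hq) (ih.1 hy)
    have h2 : a * (q * b) * y ∈ subMul Q M :=
      mul_mem_subMul (hWQ (mul_mem_subMul ha (mul_mem_subMul (hQV hq) hb))) hy
    have h3 : q * (b * (a * y)) ∈ subMul Q M := by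
      obtain ⟨m, hm, z, hz, hmz⟩ := Submodule.mem_sup.1 (ih.2 b hb a ha y hy)
      rw [← hmz, mul_add, h.mul_annihilatorIn (hQV hq) hz, add_zero]
      exact mul_mem_subMul hq hm
    have h4 := Submodule.add_mem_sup (Submodule.sub_mem _ h2 h3) h1
    convert h4 using 1
    simp only [LinearMap.comp_apply, LinearMap.mulLeft_apply]
    abel

/-- A subalgebra generated, modulo a part acting nilpotently on `U`, by finitely many elements
of `U` is nilpotent. -/
theorem exists_iterate_subMul_eq_bot (h2 : (2 : K) ≠ 0) {Q : Submodule K A} (hQV : Q ≤ V)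
    (hWQ : subMul U (subMul V U) ≤ Q) (hQ : EventuallyMaps Q U (annihilatorIn U)) (T : Finset A)
    (hT : ∀ t ∈ T, t ∈ U) (hTQ : ∀ t ∈ T, ∀ t' ∈ T, t * t' ∈ Q) :
    ∃ n, (subMul (subMul Q U ⊔ annihilatorIn U ⊔ Q ⊔ Submodule.span K (T : Set A)))^[n]
      (subMul Q U ⊔ annihilatorIn U ⊔ Q ⊔ Submodule.span K (T : Set A)) = ⊥ := by
  set I := annihilatorIn U with hI
  set S' := subMul Q U ⊔ I ⊔ Q with hS'
  set S := S' ⊔ Submodule.span K (T : Set A) with hS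
  let M (j : ℕ) : Submodule K A := (subMul Q)^[j] U
  let X (j : ℕ) : Submodule K A := M j ⊔ I ⊔ subMul U (M j)
  have hM : ∀ j, M (j + 1) = subMul Q (M j) := fun j => Function.iterate_succ_apply' _ _ _
  have hMU : ∀ j, M j ≤ U := fun j => (h.mul_mul_iterate_mem hQV hWQ j).1
  have hUM : ∀ j, ∀ a ∈ U, ∀ b ∈ U, ∀ y ∈ M j, a * (b * y) ∈ M j ⊔ I :=
    fun j => (h.mul_mul_iterate_mem hQV hWQ j).2
  have hMM : ∀ j, M (j + 1) ≤ M j := by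
    intro j
    induction j with
    | zero => exact hMU 1
    | succ j ih => exact (hM (j + 1)).le.trans ((subMul_mono le_rfl ih).trans (hM j).ge)
  have hNV : ∀ j, subMul U (M j) ≤ V := fun j =>
    subMul_le.2 fun a ha b hb => h.mul_uu a ha b (hMU j hb)
  have hVI : ∀ v ∈ V, ∀ x ∈ I, v * x = 0 := fun v hv x hx => h.mul_annihilatorIn hv hx
  have hMX : ∀ j, M j ≤ X j := fun j => le_sup_left.trans le_sup_left
  have hIX : ∀ j, I ≤ X j := fun j => le_sup_right.trans le_sup_left
  have hNX : ∀ j, subMul U (M j) ≤ X j := fun j => le_sup_right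
  have hMIX : ∀ j, M j ⊔ I ≤ X j := fun j => le_sup_left
  have hcases : ∀ {j : ℕ} {f : A →ₗ[K] A} {R : Submodule K A}, (∀ y ∈ M j, f y ∈ R) →
      (∀ y ∈ I, f y ∈ R) → (∀ y ∈ subMul U (M j), f y ∈ R) → ∀ x ∈ X j, f x ∈ R := by
    intro j f R h1 h2 h3
    exact (sup_le (sup_le h1 h2) h3 : X j ≤ R.comap f)
  have hUX : ∀ j, ∀ t ∈ U, ∀ x ∈ X j, t * x ∈ X j := by
    intro j t ht
    refine hcases (f := LinearMap.mulLeft K t) (fun y hy => ?_) (fun y hy => ?_) (fun y hy => ?_)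
    · exact hNX j (mul_mem_subMul ht hy)
    · rw [LinearMap.mulLeft_apply, hy.2 t ht]; exact Submodule.zero_mem _
    · exact hMIX j (map_mem_of_mem_subMul (LinearMap.mulLeft K t)
        (fun a ha b hb => hUM j t ht a ha b hb) hy)
  have hS'X : ∀ j, ∀ s ∈ S', ∀ x ∈ X j, s * x ∈ X (j + 1) := by
    intro j s hs x hx
    revert s
    refine (sup_le (sup_le (subMul_le.2 fun q hq a ha => ?_) fun s hs => ?_) fun q hq => ?_ :
      S' ≤ (X (j + 1)).comap (LinearMap.mulRight K x))
    · change (q * a) * x ∈ X (j + 1)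
      refine hcases (j := j) (f := LinearMap.mulLeft K (q * a)) (R := X (j + 1))
        (fun y hy => ?_) (fun y hy => ?_) (fun y hy => ?_) x hx
      · rw [LinearMap.mulLeft_apply, mul_comm,
          eq_neg_of_add_eq_zero_left (h.skew y (hMU j hy) a ha q (hQV hq))]
        exact Submodule.neg_mem _ (hNX _ (mul_mem_subMul ha (hM j ▸ mul_mem_subMul hq hy)))
      · rw [LinearMap.mulLeft_apply, hy.2 _ (h.mul_vu q (hQV hq) a ha)]
        exact Submodule.zero_mem _
      · refine map_mem_of_mem_subMul (LinearMap.mulLeft K (q * a)) (fun b hb y hy => ?_) hy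
        have h1 := h.anticommute (hQV hq) (h.mul_uu b hb y (hMU j hy)) ha
        have h3 : q * (b * y * a) ∈ X (j + 1) := by
          obtain ⟨m, hm, z, hz, hmz⟩ := Submodule.mem_sup.1 (hUM j a ha b hb y hy)
          rw [mul_comm (b * y), ← hmz, mul_add, hVI q (hQV hq) z hz, add_zero]
          exact hMX _ (hM j ▸ mul_mem_subMul hq hm)
        have h4 := Submodule.sub_mem _ (hIX (j + 1) h1) h3
        rw [add_sub_cancel_left, mul_comm (b * y)] at h4
        exact h4
    · change s * x ∈ X (j + 1)
      refine hcases (j := j) (f := LinearMap.mulLeft K s) (R := X (j + 1))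
        (fun y hy => ?_) (fun y hy => ?_) (fun y hy => ?_) x hx
      · rw [LinearMap.mulLeft_apply, mul_comm, hs.2 y (hMU j hy)]; exact Submodule.zero_mem _
      · rw [LinearMap.mulLeft_apply, hy.2 s hs.1]; exact Submodule.zero_mem _
      · rw [LinearMap.mulLeft_apply, mul_comm, hVI y (hNV j hy) s hs]; exact Submodule.zero_mem _
    · change q * x ∈ X (j + 1)
      refine hcases (j := j) (f := LinearMap.mulLeft K q) (R := X (j + 1))
        (fun y hy => ?_) (fun y hy => ?_) (fun y hy => ?_) x hx
      · exact hMX _ (hM j ▸ mul_mem_subMul hq hy)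
      · rw [LinearMap.mulLeft_apply, hVI q (hQV hq) y hy]; exact Submodule.zero_mem _
      · exact hIX _ (h.vv_mem_annihilatorIn (hQV hq) (hNV j hy))
  have hstep : ∀ j, EventuallyMaps S (X j) (X (j + 1)) := by
    intro j
    refine eventuallyMaps_of_anticommute h2 T S' (X j) (X (j + 1)) ?_ (hS'X j)
      (fun t ht => hUX j t (hT t ht)) (fun t ht => hUX (j + 1) t (hT t ht)) ?_
    · exact sup_le_sup (sup_le_sup (hMM j) le_rfl) (subMul_mono le_rfl (hMM j))
    · intro t ht t' ht'
      refine hcases (f := LinearMap.mulLeft K t ∘ₗ LinearMap.mulLeft K t' +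
        LinearMap.mulLeft K t' ∘ₗ LinearMap.mulLeft K t) (fun y hy => ?_) (fun y hy => ?_)
        (fun y hy => ?_)
      · have h1 := h.add_swap (hT t ht) (hT t' ht') (hMU j hy)
        have h3 : -(t * t' * y) ∈ X (j + 1) :=
          Submodule.neg_mem _ (hMX _ (hM j ▸ mul_mem_subMul (hTQ t ht t' ht') hy))
        rw [← h1] at h3
        exact h3
      · simp [hy.2 t (hT t ht), hy.2 t' (hT t' ht')]
      · have h1 := h.skew t (hT t ht) t' (hT t' ht') y (hNV j hy)
        rw [mul_comm y, mul_comm y] at h1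
        simp [h1]
  have hchain : ∀ j, EventuallyMaps S (X 0) (X j) := by
    intro j
    induction j with
    | zero => exact ⟨0, le_rfl⟩
    | succ j ih => exact ih.trans (hstep j)
  obtain ⟨k, hk⟩ := hQ
  have hXI : X k ≤ I := sup_le (sup_le hk le_rfl) (subMul_le.2 fun a ha y hy => by
    rw [(hk hy).2 a ha]; exact Submodule.zero_mem _)
  have hSX : S ≤ X 0 := by
    refine sup_le (sup_le (sup_le ?_ (hIX 0)) ?_) ?_
    · exact (hMU 1).trans (hMX 0)
    · exact (hQV.trans h.le_subMul).trans (hNX 0)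
    · exact (Submodule.span_le.2 hT : _ ≤ U).trans (hMX 0)
  have hSI : subMul S I ≤ ⊥ := by
    refine subMul_le.2 fun s hs x hx => ?_
    have hs : s ∈ U ⊔ V := by
      refine (sup_le (sup_le (sup_le ?_ ?_) ?_) ?_ : S ≤ U ⊔ V) hs
      · exact (hMU 1).trans le_sup_left
      · exact annihilatorIn_le.trans le_sup_left
      · exact hQV.trans le_sup_right
      · exact (Submodule.span_le.2 hT : _ ≤ U).trans le_sup_left
    obtain ⟨a, ha, v, hv, rfl⟩ := Submodule.mem_sup.1 hs
    rw [add_mul, hx.2 a ha, hVI v hv x hx, add_zero]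
    exact Submodule.zero_mem _
  obtain ⟨n, hn⟩ := (hchain k).trans (EventuallyMaps.trans ⟨0, hXI⟩ ⟨1, hSI⟩)
  exact ⟨n, le_bot_iff.1 ((monotone_iterate_subMul S n hSX).trans hn)⟩

theorem mul_mem_generated {Q : Submodule K A} (hQV : Q ≤ V) (hWQ : subMul U (subMul V U) ≤ Q)
    (T : Finset A) (hT : ∀ t ∈ T, t ∈ U) (hTQ : ∀ t ∈ T, ∀ t' ∈ T, t * t' ∈ Q) :
    ∀ x ∈ subMul Q U ⊔ annihilatorIn U ⊔ Q ⊔ Submodule.span K (T : Set A),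
      ∀ y ∈ subMul Q U ⊔ annihilatorIn U ⊔ Q ⊔ Submodule.span K (T : Set A),
      x * y ∈ subMul Q U ⊔ annihilatorIn U ⊔ Q ⊔ Submodule.span K (T : Set A) := by
  set P := subMul Q U ⊔ annihilatorIn U ⊔ Submodule.span K (T : Set A) with hP
  have hTU : Submodule.span K (T : Set A) ≤ U := Submodule.span_le.2 hT
  have hQU : subMul Q U ≤ U := subMul_le.2 fun q hq a ha => h.mul_vu q (hQV hq) a ha
  have hPU : P ≤ U := sup_le (sup_le hQU annihilatorIn_le) hTU
  have hUQU : subMul U (subMul Q U) ≤ Q :=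
    (subMul_mono le_rfl (subMul_mono hQV le_rfl)).trans hWQ
  have hUI : ∀ a ∈ U, ∀ x ∈ annihilatorIn U, a * x ∈ Q := fun a ha x hx => by
    rw [hx.2 a ha]; exact Q.zero_mem
  have hTT : subMul (Submodule.span K (T : Set A)) (Submodule.span K (T : Set A)) ≤ Q := by
    rw [subMul, Submodule.map₂_span_span, Submodule.span_le]
    rintro _ ⟨t, ht, t', ht', rfl⟩
    exact hTQ t ht t' ht'
  have hPP : ∀ x ∈ P, ∀ y ∈ P, x * y ∈ Q := by
    intro x hx y hy
    obtain ⟨x', hx', x₃, hx₃, rfl⟩ := Submodule.mem_sup.1 hx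
    obtain ⟨x₁, hx₁, x₂, hx₂, rfl⟩ := Submodule.mem_sup.1 hx'
    obtain ⟨y', hy', y₃, hy₃, rfl⟩ := Submodule.mem_sup.1 hy
    obtain ⟨y₁, hy₁, y₂, hy₂, rfl⟩ := Submodule.mem_sup.1 hy'
    have hy₀ := hPU hy
    rw [add_mul, add_mul, mul_comm x₁, mul_comm x₂, mul_add x₃, mul_add x₃]
    refine Q.add_mem (Q.add_mem ?_ (hUI _ hy₀ x₂ hx₂)) (Q.add_mem (Q.add_mem ?_ ?_) ?_)
    · exact hUQU (mul_mem_subMul hy₀ hx₁)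
    · exact hUQU (mul_mem_subMul (hTU hx₃) hy₁)
    · exact hUI _ (hTU hx₃) y₂ hy₂
    · exact hTT (mul_mem_subMul hx₃ hy₃)
  have hS : subMul Q U ⊔ annihilatorIn U ⊔ Q ⊔ Submodule.span K (T : Set A) = P ⊔ Q :=
    sup_right_comm _ _ _
  have hQUP : subMul Q U ≤ P := le_sup_left.trans le_sup_left
  have hIP : annihilatorIn U ≤ P := le_sup_right.trans le_sup_left
  rw [hS]
  intro x hx y hy
  obtain ⟨p, hp, q, hq, rfl⟩ := Submodule.mem_sup.1 hx
  obtain ⟨p', hp', q', hq', rfl⟩ := Submodule.mem_sup.1 hy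
  have : (p + q) * (p' + q') = (q' * p + q * p' + q * q') + p * p' := by
    rw [add_mul, mul_add, mul_add, mul_comm p q']; abel
  rw [this]
  refine Submodule.add_mem_sup (P.add_mem (P.add_mem ?_ ?_) ?_) (hPP p hp p' hp')
  · exact hQUP (mul_mem_subMul hq' (hPU hp))
  · exact hQUP (mul_mem_subMul hq (hPU hp'))
  · exact hIP (h.vv_mem_annihilatorIn (hQV hq) (hQV hq'))


theorem exists_finset_of_mem_sup {x : A} (hx : x ∈ U ⊔ V) :
    ∃ T : Finset A, (∀ t ∈ T, t ∈ U) ∧ x ∈ Submodule.span K (T : Set A) ⊔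
      subMul (Submodule.span K (T : Set A)) (Submodule.span K (T : Set A)) := by
  classical
  have hmono : ∀ {T T' : Finset A}, T ⊆ T' →
      subMul (Submodule.span K (T : Set A)) (Submodule.span K (T : Set A)) ≤
        subMul (Submodule.span K (T' : Set A)) (Submodule.span K (T' : Set A)) := fun hT =>
    subMul_mono (Submodule.span_mono (Finset.coe_subset.2 hT))
      (Submodule.span_mono (Finset.coe_subset.2 hT))
  have hV : ∀ v ∈ subMul U U, ∃ T : Finset A, (∀ t ∈ T, t ∈ U) ∧
      v ∈ subMul (Submodule.span K (T : Set A)) (Submodule.span K (T : Set A)) := by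
    intro v hv
    rw [subMul, Submodule.map₂_eq_span_image2] at hv
    induction hv using Submodule.span_induction with
    | mem x hx =>
      obtain ⟨a, ha, b, hb, rfl⟩ := hx
      refine ⟨{a, b}, by simpa using ⟨ha, hb⟩, mul_mem_subMul ?_ ?_⟩ <;>
        exact Submodule.subset_span (by simp)
    | zero => exact ⟨∅, by simp, Submodule.zero_mem _⟩
    | add x y _ _ hx hy =>
      obtain ⟨T, hTU, hT⟩ := hx
      obtain ⟨T', hTU', hT'⟩ := hy
      refine ⟨T ∪ T', fun t ht => (Finset.mem_union.1 ht).elim (hTU t) (hTU' t), ?_⟩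
      exact Submodule.add_mem _ (hmono Finset.subset_union_left hT)
        (hmono Finset.subset_union_right hT')
    | smul c x _ hx =>
      obtain ⟨T, hTU, hT⟩ := hx
      exact ⟨T, hTU, Submodule.smul_mem _ c hT⟩
  obtain ⟨u, hu, v, hv, rfl⟩ := Submodule.mem_sup.1 hx
  obtain ⟨T, hTU, hT⟩ := hV v (h.le_subMul hv)
  refine ⟨insert u T, ?_, Submodule.add_mem_sup ?_ (hmono (Finset.subset_insert u T) hT)⟩
  · intro t ht
    rcases Finset.mem_insert.1 ht with rfl | ht
    exacts [hu, hTU t ht]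
  · exact Submodule.subset_span (by simp)

theorem exists_algPow_adjoin_eq_bot (h2 : (2 : K) ≠ 0) (s : Finset A)
    (hs : ∀ x ∈ s, x ∈ U ⊔ V) :
    ∃ n, 1 ≤ n ∧ algPow (NonUnitalAlgebra.adjoin K (s : Set A)).toSubmodule n = ⊥ := by
  classical
  choose! f hfU hf using fun x (hx : x ∈ s) => h.exists_finset_of_mem_sup (hs x hx)
  let T := s.biUnion f
  have hT : ∀ t ∈ T, t ∈ U := fun t ht => by
    obtain ⟨x, hx, hxt⟩ := Finset.mem_biUnion.1 ht
    exact hfU x hx t hxt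
  let F := Finset.image₂ (· * ·) T T
  let Q := subMul U (subMul V U) ⊔ Submodule.span K (F : Set A)
  have hF : ∀ t ∈ F, t ∈ V := fun t ht => by
    obtain ⟨a, ha, b, hb, rfl⟩ := Finset.mem_image₂.1 ht
    exact h.mul_uu a (hT a ha) b (hT b hb)
  have hQV : Q ≤ V := sup_le h.subMul_subMul_le (Submodule.span_le.2 hF)
  have hWQ : subMul U (subMul V U) ≤ Q := le_sup_left
  have hTQ : ∀ t ∈ T, ∀ t' ∈ T, t * t' ∈ Q := fun t ht t' ht' =>
    Submodule.mem_sup_right (Submodule.subset_span (Finset.mem_image₂_of_mem ht ht'))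
  let S := subMul Q U ⊔ annihilatorIn U ⊔ Q ⊔ Submodule.span K (T : Set A)
  have hTS : Submodule.span K (T : Set A) ≤ S := le_sup_right
  have hS : ∀ x ∈ S, ∀ y ∈ S, x * y ∈ S := h.mul_mem_generated hQV hWQ T hT hTQ
  have hsS : ∀ x ∈ s, x ∈ S := by
    intro x hx
    have hle : Submodule.span K (f x : Set A) ≤ S :=
      (Submodule.span_mono (Finset.coe_subset.2 (Finset.subset_biUnion_of_mem f hx))).trans hTS
    exact (sup_le hle (subMul_le.2 fun a ha b hb => hS a (hle ha) b (hle hb))) (hf x hx)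
  have hadj : (NonUnitalAlgebra.adjoin K (s : Set A)).toSubmodule ≤ S := by
    intro x hx
    exact NonUnitalAlgebra.adjoin_le (S := { S with mul_mem' := fun hx hy => hS _ hx _ hy })
      hsS hx
  obtain ⟨n, hn⟩ := h.exists_iterate_subMul_eq_bot h2 hQV hWQ
    (h.eventuallyMaps_annihilatorIn h2 F hF) T hT hTQ
  exact ⟨2 ^ n, Nat.one_le_two_pow,
    le_bot_iff.1 ((algPow_le_iterate_subMul hadj hS n _ le_rfl).trans hn.le)⟩
end IsNuclearPeircePair

end Peirce

section Bernstein

variable {K A : Type*} [Field K] [NonUnitalNonAssocCommRing A] [Module K A]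
  [SMulCommClass K A A] [IsScalarTower K A A]

omit [SMulCommClass K A A] [IsScalarTower K A A] in
/-- The full linearization of the Bernstein identity. -/
theorem bernstein_linearization (h2 : (2 : K) ≠ 0) (ω : A →ₗ[K] K)
    (hbern : ∀ x : A, (x * x) * (x * x) = ω x ^ 2 • (x * x)) (x y z w : A) :
    (2 : K) • ((x * y) * (z * w) + (x * z) * (y * w) + (x * w) * (y * z)) =
      (ω x * ω y) • (z * w) + (ω x * ω z) • (y * w) + (ω x * ω w) • (y * z) +
      (ω y * ω z) • (x * w) + (ω y * ω w) • (x * z) + (ω z * ω w) • (x * y) := by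
  have hquad : ∀ x y : A, (4 : K) • ((x * x) * (y * y)) + (8 : K) • ((x * y) * (x * y)) =
      (2 * ω x ^ 2) • (y * y) + (2 * ω y ^ 2) • (x * x) + (8 * ω x * ω y) • (x * y) := by
    intro x y
    have e₁ := hbern (x + y)
    have e₂ := hbern (x - y)
    have e₃ := hbern x
    have e₄ := hbern y
    have c₁ := mul_comm y x
    have c₂ := mul_comm (y * y) (x * x)
    have c₃ := mul_comm (x * y) (x * x)
    have c₄ := mul_comm (x * y) (y * y)
    simp only [mul_add, add_mul, mul_sub, sub_mul, map_add, map_sub, c₁, c₂, c₃, c₄] at e₁ e₂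
    linear_combination (norm := module) e₁ + e₂ - (2 : K) • e₃ - (2 : K) • e₄
  have hcub : ∀ x y z : A, (8 : K) • ((x * z) * (y * y)) + (16 : K) • ((x * y) * (z * y)) =
      (4 * ω x * ω z) • (y * y) + (4 * ω y ^ 2) • (x * z) + (8 * ω x * ω y) • (z * y) +
      (8 * ω z * ω y) • (x * y) := by
    intro x y z
    have e₁ := hquad (x + z) y
    have e₂ := hquad x y
    have e₃ := hquad z y
    simp only [mul_add, add_mul, map_add, mul_comm z x, mul_comm (z * y) (x * y)] at e₁
    linear_combination (norm := module) e₁ - e₂ - e₃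
  have e₁ := hcub x (y + w) z
  have e₂ := hcub x y z
  have e₃ := hcub x w z
  simp only [mul_add, add_mul, map_add, mul_comm w y] at e₁
  have h8 : (8 : K) ≠ 0 := by
    rw [show (8 : K) = 2 ^ 3 by norm_num]
    exact pow_ne_zero 3 h2
  refine smul_right_injective A h8 ?_
  simp only [mul_comm z w, mul_comm z y] at *
  linear_combination (norm := module) e₁ - e₂ - e₃

open Module.End in
/-- The Peirce components of the barideal, relative to an idempotent `e` of weight one. -/
theorem bernstein_peirce_rules (h2 : (2 : K) ≠ 0) (ω : A →ₗ[K] K)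
    (hωmul : ∀ x y : A, ω (x * y) = ω x * ω y)
    (hbern : ∀ x : A, (x * x) * (x * x) = ω x ^ 2 • (x * x)) {e : A} (he : e * e = e)
    (hωe : ω e = 1) {U V : Submodule K A} (hU : U = eigenspace (LinearMap.mulLeft K e) 2⁻¹)
    (hV : V = LinearMap.ker (LinearMap.mulLeft K e)) :
    (∀ x ∈ U, ω x = 0) ∧ (∀ x ∈ V, ω x = 0) ∧ (∀ a ∈ U, ∀ b ∈ U, a * b ∈ V) ∧
      (∀ v ∈ V, ∀ a ∈ U, v * a ∈ U) ∧ (∀ v ∈ V, ∀ w ∈ V, v * w ∈ U) ∧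
      (∀ a ∈ U, ∀ b ∈ U, ∀ c ∈ U, a * (b * c) + b * (c * a) + c * (a * b) = 0) ∧
      (∀ a ∈ U, ∀ b ∈ U, ∀ v ∈ V, a * (v * b) + b * (v * a) = 0) ∧
      (∀ a ∈ U, ∀ v ∈ V, ∀ w ∈ V, a * (v * w) = 0) ∧
      (∀ a ∈ U, ∀ b ∈ U, ∀ v ∈ V, ∀ w ∈ V,
        a * b * (v * w) + v * a * (w * b) + w * a * (v * b) = 0) := by
  have memU : ∀ x, x ∈ U ↔ e * x = (2⁻¹ : K) • x := fun x => by
    rw [hU, mem_eigenspace_iff, LinearMap.mulLeft_apply]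
  have memV : ∀ x, x ∈ V ↔ e * x = 0 := fun x => by
    rw [hV, LinearMap.mem_ker, LinearMap.mulLeft_apply]
  have hωU : ∀ x ∈ U, ω x = 0 := by
    intro x hx
    have h := congrArg ω ((memU x).1 hx)
    rw [hωmul, hωe, map_smul, smul_eq_mul, one_mul] at h
    field_simp at h
    linear_combination h
  have hωV : ∀ x ∈ V, ω x = 0 := by
    intro x hx
    have h := congrArg ω ((memV x).1 hx)
    rwa [hωmul, hωe, one_mul, map_zero] at h
  have lin := bernstein_linearization h2 ω hbern
  have lin₂ : ∀ x y, ω x = 0 → ω y = 0 →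
      e * (x * y) = (2⁻¹ : K) • (x * y) - (2 : K) • ((e * x) * (e * y)) := by
    intro x y hx hy
    have h := lin e e x y
    rw [he, hωe, hx, hy, mul_comm (e * y)] at h
    refine smul_right_injective A h2 ?_
    simp only [mul_zero, zero_smul, smul_sub, smul_smul, mul_inv_cancel₀ h2] at h ⊢
    linear_combination (norm := module) h
  have lin₃ : ∀ x y z, ω x = 0 → ω y = 0 → ω z = 0 →
      (e * x) * (y * z) + (e * y) * (x * z) + (e * z) * (x * y) = 0 := by
    intro x y z hx hy hz
    have h := lin e x y z
    simp only [hx, hy, hz, mul_zero, zero_smul, add_zero] at h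
    exact (smul_eq_zero.1 h).resolve_left h2
  have lin₄ : ∀ x y z w, ω x = 0 → ω y = 0 → ω z = 0 → ω w = 0 →
      (x * y) * (z * w) + (x * z) * (y * w) + (x * w) * (y * z) = 0 := by
    intro x y z w hx hy hz hw
    have h := lin x y z w
    simp only [hx, hy, hz, hw, mul_zero, zero_smul, add_zero] at h
    exact (smul_eq_zero.1 h).resolve_left h2
  refine ⟨hωU, hωV, ?_, ?_, ?_, ?_, ?_, ?_, ?_⟩
  · intro a ha b hb
    rw [memV, lin₂ a b (hωU a ha) (hωU b hb), (memU a).1 ha, (memU b).1 hb, smul_mul_assoc,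
      mul_smul_comm, smul_smul, smul_smul, mul_inv_cancel₀ h2, one_mul, sub_self]
  · intro v hv a ha
    rw [memU, lin₂ v a (hωV v hv) (hωU a ha), (memV v).1 hv, zero_mul, smul_zero, sub_zero]
  · intro v hv w hw
    rw [memU, lin₂ v w (hωV v hv) (hωV w hw), (memV v).1 hv, zero_mul, smul_zero, sub_zero]
  · intro a ha b hb c hc
    have h := lin₃ a b c (hωU a ha) (hωU b hb) (hωU c hc)
    rw [(memU a).1 ha, (memU b).1 hb, (memU c).1 hc, smul_mul_assoc, smul_mul_assoc,
      smul_mul_assoc, ← smul_add, ← smul_add, mul_comm a c] at h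
    exact (smul_eq_zero.1 h).resolve_left (inv_ne_zero h2)
  · intro a ha b hb v hv
    have h := lin₃ a b v (hωU a ha) (hωU b hb) (hωV v hv)
    rw [(memU a).1 ha, (memU b).1 hb, (memV v).1 hv, zero_mul, add_zero, smul_mul_assoc,
      smul_mul_assoc, ← smul_add, mul_comm a v, mul_comm b v] at h
    exact (smul_eq_zero.1 h).resolve_left (inv_ne_zero h2)
  · intro a ha v hv w hw
    have h := lin₃ a v w (hωU a ha) (hωV v hv) (hωV w hw)
    rw [(memU a).1 ha, (memV v).1 hv, (memV w).1 hw, zero_mul, zero_mul, add_zero, add_zero,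
      smul_mul_assoc] at h
    exact (smul_eq_zero.1 h).resolve_left (inv_ne_zero h2)
  · intro a ha b hb v hv w hw
    have h := lin₄ a b v w (hωU a ha) (hωU b hb) (hωV v hv) (hωV w hw)
    rwa [mul_comm a v, mul_comm b w, mul_comm a w, mul_comm b v] at h

open Module.End in
omit [IsScalarTower K A A] in
/-- The Peirce decomposition of a Bernstein algebra. -/
theorem bernstein_peirce_decomposition (h2 : (2 : K) ≠ 0) (h3 : (3 : K) ≠ 0) (ω : A →ₗ[K] K)
    (hbern : ∀ x : A, (x * x) * (x * x) = ω x ^ 2 • (x * x)) {e : A} (he : e * e = e)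
    (hωe : ω e = 1) (x : A) :
    ∃ c : K, ∃ a ∈ eigenspace (LinearMap.mulLeft K e) 2⁻¹,
      ∃ v ∈ LinearMap.ker (LinearMap.mulLeft K e), x = c • e + a + v := by
  have hidem : ∀ n, ω n = 0 → (2 : K) • (e * (e * n)) = e * n := by
    intro n hn
    have h := bernstein_linearization h2 ω hbern e e e n
    rw [he, hωe, hn] at h
    refine smul_right_injective A h3 ?_
    simp only [mul_zero, zero_smul, mul_one, one_smul, add_zero, mul_comm (e * n) e] at h ⊢
    linear_combination (norm := module) h
  obtain ⟨n, hn⟩ : ∃ n, n = x - ω x • e := ⟨_, rfl⟩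
  have h := hidem n (by rw [hn, map_sub, map_smul, hωe, smul_eq_mul, mul_one, sub_self])
  refine ⟨ω x, (2 : K) • (e * n), ?_, n - (2 : K) • (e * n), ?_, ?_⟩
  · rw [mem_eigenspace_iff, LinearMap.mulLeft_apply, mul_smul_comm, h, inv_smul_smul₀ h2]
  · rw [LinearMap.mem_ker, LinearMap.mulLeft_apply, mul_sub, mul_smul_comm, h, sub_self]
  · rw [hn]; abel

/-- The barideal of a nuclear Bernstein algebra is the sum of a nuclear Peirce pair. -/
theorem exists_isNuclearPeircePair (h2 : (2 : K) ≠ 0) (h3 : (3 : K) ≠ 0) (ω : A →ₗ[K] K)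
    (hωmul : ∀ x y : A, ω (x * y) = ω x * ω y) (hω0 : ω ≠ 0)
    (hbern : ∀ x : A, (x * x) * (x * x) = ω x ^ 2 • (x * x))
    (hnuclear : subMul (⊤ : Submodule K A) ⊤ = ⊤) :
    ∃ U V : Submodule K A, IsNuclearPeircePair U V ∧ LinearMap.ker ω ≤ U ⊔ V := by
  obtain ⟨x, hx⟩ : ∃ x, ω x = 1 := LinearMap.surjective hω0 1
  obtain ⟨e, rfl⟩ : ∃ e, e = x * x := ⟨_, rfl⟩
  have he := hbern x
  rw [hx, one_pow, one_smul] at he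
  have hωe : ω (x * x) = 1 := by rw [hωmul, hx, one_mul]
  generalize x * x = e at he hωe
  obtain ⟨U, hU⟩ : ∃ U, U = Module.End.eigenspace (LinearMap.mulLeft K e) 2⁻¹ := ⟨_, rfl⟩
  obtain ⟨V, hV⟩ : ∃ V, V = LinearMap.ker (LinearMap.mulLeft K e) := ⟨_, rfl⟩
  obtain ⟨hωU, hωV, uu, vu, vv, jac, skew, uvv, quart⟩ :=
    bernstein_peirce_rules h2 ω hωmul hbern he hωe hU hV
  have hUV : subMul U U ≤ V := subMul_le.2 uu
  refine ⟨U, subMul U U, ⟨fun a ha b hb => mul_mem_subMul ha hb, fun v hv => vu v (hUV hv),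
    fun v hv w hw => vv v (hUV hv) w (hUV hw), jac, fun a ha b hb v hv => skew a ha b hb v (hUV hv),
    fun a ha v hv w hw => uvv a ha v (hUV hv) w (hUV hw),
    fun a ha b hb v hv w hw => quart a ha b hb v (hUV hv) w (hUV hw), le_rfl⟩, ?_⟩
  have htop : (⊤ : Submodule K A) ≤ Submodule.span K {e} ⊔ (U ⊔ subMul U U) := by
    rw [← hnuclear]
    refine subMul_le.2 fun x _ y _ => ?_
    obtain ⟨c, a, ha, v, hv, rfl⟩ := bernstein_peirce_decomposition h2 h3 ω hbern he hωe x
    obtain ⟨d, b, hb, w, hw, rfl⟩ := bernstein_peirce_decomposition h2 h3 ω hbern he hωe y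
    have hea : e * a = (2⁻¹ : K) • a := Module.End.mem_eigenspace_iff.1 ha
    have heb : e * b = (2⁻¹ : K) • b := Module.End.mem_eigenspace_iff.1 hb
    have hev : e * v = 0 := hv
    have hew : e * w = 0 := hw
    rw [← hU] at ha hb
    rw [← hV] at hv hw
    have hxy : (c • e + a + v) * (d • e + b + w) = (c * d) • e +
        (((c * 2⁻¹) • b + (d * 2⁻¹) • a + w * a + v * b + v * w) + a * b) := by
      simp only [add_mul, mul_add, smul_mul_assoc, mul_smul_comm, he, heb, hew, mul_comm a e,
        mul_comm v e, hea, hev, mul_comm a w]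
      module
    rw [hxy]
    refine Submodule.add_mem_sup (Submodule.smul_mem _ _ (Submodule.mem_span_singleton_self e))
      (Submodule.add_mem_sup ?_ (mul_mem_subMul ha hb))
    exact U.add_mem (U.add_mem (U.add_mem (U.add_mem (U.smul_mem _ hb) (U.smul_mem _ ha))
      (vu w hw a ha)) (vu v hv b hb)) (vv v hv w hw)
  intro n hn
  obtain ⟨y, hy, m, hm, rfl⟩ := Submodule.mem_sup.1 (htop (Submodule.mem_top (x := n)))
  obtain ⟨c, rfl⟩ := Submodule.mem_span_singleton.1 hy
  have hωm : ω m = 0 :=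
    (sup_le hωU fun v hv => hωV v (hUV hv) : U ⊔ subMul U U ≤ LinearMap.ker ω) hm
  rw [LinearMap.mem_ker, map_add, map_smul, hωe, hωm, smul_eq_mul, mul_one, add_zero] at hn
  rwa [hn, zero_smul, zero_add]

end Bernstein

/-- Let `A` be a nuclear Bernstein algebra over a field `K` of characteristic
`≠ 2, 3`, i.e. a Bernstein algebra with `A² = A`.  Then the barideal `N = ker ω` is locally
nilpotent: every finitely generated subalgebra of `N` is nilpotent. -/
theorem nuclear_bernstein_barideal_locallyNilpotent {K A : Type*} [Field K]
    [NonUnitalNonAssocCommRing A] [Module K A] [SMulCommClass K A A] [IsScalarTower K A A]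
    (h2 : (2 : K) ≠ 0) (h3 : (3 : K) ≠ 0)
    (ω : A →ₗ[K] K) (hωmul : ∀ x y : A, ω (x * y) = ω x * ω y) (hω0 : ω ≠ 0)
    (hbern : ∀ x : A, (x * x) * (x * x) = ω x ^ 2 • (x * x))
    -- `A` is nuclear : `A² = A`
    (hnuclear : subMul (⊤ : Submodule K A) ⊤ = ⊤) :
    -- `N = ker ω` is locally nilpotent
    ∀ s : Finset A, (↑s : Set A) ⊆ (LinearMap.ker ω : Set A) →
      ∃ n, 1 ≤ n ∧ algPow (NonUnitalAlgebra.adjoin K (↑s : Set A)).toSubmodule n = ⊥ := by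
  obtain ⟨U, V, h, hker⟩ := exists_isNuclearPeircePair h2 h3 ω hωmul hω0 hbern hnuclear
  exact fun s hs => h.exists_algPow_adjoin_eq_bot h2 s fun x hx => hker (hs hx)
end
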